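/- Let K be a field of characteristic zero and let n ≥ 1 and r ≥ 1 be integers. Then there exists a nonzero polynomial G in 4n variables over K such that for every tuple (v_1,…,v_n) of nonzero vectors in K^4 with G(v_1,…,v_n) ≠ 0, the ideal I = ⋂_{j=1}^n m_{v_j} of the corresponding simple points in P^3 satisfies I^{(3r-2)} ⊆ I^r (the Harbourne–Huneke containment conjecture for simple points in general position in P^3). -/

import Mathlib

open MvPolynomial Filter

noncomputable section

/-- The ideal of a point of `ℙ³` represented by a nonzero vector `v ∈ K⁴`:
the ideal generated by all linear forms vanishing at `v`. -/
def pointIdeal (K : Type) [Field K] (v : Fin 4 → K) : Ideal (MvPolynomial (Fin 4) K) :=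
  Ideal.span {f | f.IsHomogeneous 1 ∧ eval v f = 0}

section PointIdeal

theorem mem_pow_idealOfVars_of_mul_mem {σ A : Type*} [CommRing A] [IsDomain A]
    {u f : MvPolynomial σ A} {a : ℕ} (hu : coeff 0 u ≠ 0)
    (h : u * f ∈ idealOfVars σ A ^ a) : f ∈ idealOfVars σ A ^ a := by
  classical
  rw [mem_pow_idealOfVars_iff'] at h ⊢
  intro x
  induction hN : x.degree using Nat.strong_induction_on generalizing x with
  | _ N ih =>
    intro hx
    have h0 := h x (hN ▸ hx)
    rw [coeff_mul, Finset.sum_eq_single (0, x)] at h0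
    · exact (mul_eq_zero.1 h0).resolve_left hu
    · rintro ⟨y, z⟩ hyz hne
      rw [Finset.HasAntidiagonal.mem_antidiagonal] at hyz
      simp only at hyz ⊢
      have hdeg : y.degree + z.degree = N := by rw [← hN, ← hyz, map_add]
      have hy : y.degree ≠ 0 := by
        intro hy
        rw [Finsupp.degree_eq_zero_iff] at hy
        subst hy
        simp_all
      rw [ih z.degree (by omega) z rfl (by omega), mul_zero]
    · simp

variable {K : Type} [Field K]

/-- The expansion of a polynomial in four variables along the line through the origin and `v`. -/
def lineExpansion (v : Fin 4 → K) :
    MvPolynomial (Fin 4) K →ₐ[K] MvPolynomial (Fin 3) (Polynomial K) :=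
  aeval (Fin.cons (C (Polynomial.C (v 0) * Polynomial.X))
    fun i => X i + C (Polynomial.C (v i.succ) * Polynomial.X))

theorem coeff_zero_lineExpansion (v : Fin 4 → K) (f : MvPolynomial (Fin 4) K) :
    coeff 0 (lineExpansion v f) =
      aeval (fun i => Polynomial.C (v i) * Polynomial.X) f := by
  have : ((Algebra.ofId (Polynomial K) (Polynomial K)).restrictScalars K).comp
      (((aeval (fun _ => 0) : MvPolynomial (Fin 3) (Polynomial K) →ₐ[Polynomial K]
        Polynomial K).restrictScalars K).comp (lineExpansion v)) =
      aeval (fun i => Polynomial.C (v i) * Polynomial.X) := by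
    ext i
    refine Fin.cases ?_ (fun i => ?_) i <;> simp [lineExpansion]
  rw [← this]
  simp [← constantCoeff_eq]

theorem aeval_C_mul_X_of_isHomogeneous (v : Fin 4 → K) {f : MvPolynomial (Fin 4) K} {d : ℕ}
    (hf : f.IsHomogeneous d) :
    aeval (fun i => Polynomial.C (v i) * Polynomial.X) f =
      Polynomial.C (eval v f) * Polynomial.X ^ d := by
  rw [aeval_def, eval₂_eq, eval_eq, map_sum, Finset.sum_mul]
  refine Finset.sum_congr rfl fun x hx => ?_
  have hd : ∑ i ∈ x.support, x i = d := by
    rw [← hf.degree_eq_sum_deg_support hx]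
  simp only [mul_pow, Finset.prod_mul_distrib, Finset.prod_pow_eq_pow_sum, hd, map_mul, map_prod,
    map_pow, Polynomial.algebraMap_eq]
  ring

theorem lineExpansion_coeff_zero_ne {v : Fin 4 → K} {f : MvPolynomial (Fin 4) K}
    (hf : eval v f ≠ 0) : coeff 0 (lineExpansion v f) ≠ 0 := by
  rw [coeff_zero_lineExpansion]
  intro h
  apply hf
  have := congrArg (Polynomial.aeval (1 : K)) h
  rw [← AlgHom.comp_apply, comp_aeval] at this
  simpa [aeval_def, eval₂_eq, eval_eq] using this

theorem eval_eq_zero_of_mem_pointIdeal {v : Fin 4 → K} {f : MvPolynomial (Fin 4) K}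
    (hf : f ∈ pointIdeal K v) : eval v f = 0 := by
  have : pointIdeal K v ≤ RingHom.ker (eval v) := Ideal.span_le.2 fun g hg => hg.2
  exact this hf

theorem map_lineExpansion_le (v : Fin 4 → K) :
    (pointIdeal K v).map (lineExpansion v) ≤ idealOfVars (Fin 3) (Polynomial K) := by
  rw [Ideal.map_le_iff_le_comap, pointIdeal, Ideal.span_le]
  rintro f ⟨hf, h0⟩
  rw [SetLike.mem_coe, Ideal.mem_comap, ← pow_one (idealOfVars _ _), mem_pow_idealOfVars_iff']
  intro x hx
  obtain rfl : x = 0 := by rw [← Finsupp.degree_eq_zero_iff]; omega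
  change coeff 0 (lineExpansion v f) = 0
  rw [coeff_zero_lineExpansion, aeval_C_mul_X_of_isHomogeneous v hf, h0]
  simp

/-- The inverse change of coordinates to `lineExpansion`. -/
def lineExpansionInv (v : Fin 4 → K) :
    MvPolynomial (Fin 3) (Polynomial K) →+* MvPolynomial (Fin 4) K :=
  eval₂Hom (Polynomial.aeval (C (v 0)⁻¹ * X 0 : MvPolynomial (Fin 4) K)).toRingHom
    fun i => X i.succ - C (v i.succ * (v 0)⁻¹) * X 0

theorem lineExpansionInv_lineExpansion {v : Fin 4 → K} (hv : v 0 ≠ 0)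
    (f : MvPolynomial (Fin 4) K) : lineExpansionInv v (lineExpansion v f) = f := by
  have : (lineExpansionInv v).comp (lineExpansion v).toRingHom = RingHom.id _ := by
    refine MvPolynomial.ringHom_ext (fun r => ?_) fun i => ?_
    · simp [lineExpansion, lineExpansionInv, MvPolynomial.algebraMap_apply,
        MvPolynomial.algebraMap_eq]
    · refine Fin.cases ?_ (fun i => ?_) i
      · have h : (C (v 0) * C (v 0)⁻¹ : MvPolynomial (Fin 4) K) = 1 := by
          rw [← C_mul, mul_inv_cancel₀ hv, C_1]
        simp [lineExpansion, lineExpansionInv, MvPolynomial.algebraMap_eq, ← mul_assoc, h]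
      · simp [lineExpansion, lineExpansionInv, MvPolynomial.algebraMap_eq, ← mul_assoc]
  exact congrArg (fun φ : MvPolynomial (Fin 4) K →+* MvPolynomial (Fin 4) K => φ f) this

theorem map_lineExpansionInv_le {v : Fin 4 → K} (hv : v 0 ≠ 0) :
    (idealOfVars (Fin 3) (Polynomial K)).map (lineExpansionInv v) ≤ pointIdeal K v := by
  rw [Ideal.map_le_iff_le_comap, Ideal.span_le]
  rintro _ ⟨i, rfl⟩
  refine Ideal.subset_span ⟨?_, ?_⟩
  · simpa [lineExpansionInv] using
      (isHomogeneous_X K i.succ).sub (isHomogeneous_C_mul_X (v i.succ * (v 0)⁻¹) 0)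
  · simp [lineExpansionInv, hv]

theorem mem_pointIdeal_pow_iff {v : Fin 4 → K} (hv : v 0 ≠ 0) {f : MvPolynomial (Fin 4) K}
    {a : ℕ} : f ∈ pointIdeal K v ^ a ↔
      lineExpansion v f ∈ idealOfVars (Fin 3) (Polynomial K) ^ a := by
  constructor
  · intro h
    exact Ideal.pow_right_mono (map_lineExpansion_le v) a
      (Ideal.map_pow (lineExpansion v) (pointIdeal K v) a ▸ Ideal.mem_map_of_mem _ h)
  · intro h
    rw [← lineExpansionInv_lineExpansion hv f]
    exact Ideal.pow_right_mono (map_lineExpansionInv_le hv) a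
      (Ideal.map_pow (lineExpansionInv v) _ a ▸ Ideal.mem_map_of_mem _ h)

theorem mem_pointIdeal_pow_of_mul_mem {v : Fin 4 → K} (hv : v 0 ≠ 0)
    {u f : MvPolynomial (Fin 4) K} {a : ℕ} (hu : eval v u ≠ 0)
    (h : u * f ∈ pointIdeal K v ^ a) : f ∈ pointIdeal K v ^ a := by
  rw [mem_pointIdeal_pow_iff hv] at h ⊢
  rw [map_mul] at h
  exact mem_pow_idealOfVars_of_mul_mem (lineExpansion_coeff_zero_ne hu) h

theorem mem_pointIdeal_of_isHomogeneous {v : Fin 4 → K} (hv : v 0 ≠ 0)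
    {f : MvPolynomial (Fin 4) K} {d : ℕ} (hf : f.IsHomogeneous d) (h0 : eval v f = 0) :
    f ∈ pointIdeal K v := by
  rw [← pow_one (pointIdeal K v), mem_pointIdeal_pow_iff hv, mem_pow_idealOfVars_iff']
  intro x hx
  obtain rfl : x = 0 := by rw [← Finsupp.degree_eq_zero_iff]; omega
  rw [coeff_zero_lineExpansion, aeval_C_mul_X_of_isHomogeneous v hf, h0]
  simp

/-- A form of degree `d` in an ideal generated by forms of degree `e` is a linear combination of
products of generators with forms of the complementary degree. -/
theorem mem_span_mul_of_isHomogeneous {σ : Type*} {T : Set (MvPolynomial σ K)} {e d : ℕ}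
    (hT : ∀ g ∈ T, g.IsHomogeneous e) {f : MvPolynomial σ K} (hf : f ∈ Ideal.span T)
    (hd : f.IsHomogeneous d) :
    f ∈ Submodule.span K {x | ∃ g ∈ T, ∃ k h, e + k = d ∧ IsHomogeneous h k ∧ x = g * h} := by
  suffices H : ∀ a, homogeneousComponent d (a * f) ∈
      Submodule.span K {x | ∃ g ∈ T, ∃ k h, e + k = d ∧ IsHomogeneous h k ∧ x = g * h} by
    simpa [homogeneousComponent_of_mem hd] using H 1
  clear hd
  induction hf using Submodule.span_induction with
  | mem g hg =>
    intro a
    rw [← sum_homogeneousComponent a, Finset.sum_mul, map_sum]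
    refine Submodule.sum_mem _ fun k _ => ?_
    rw [homogeneousComponent_of_mem ((homogeneousComponent_isHomogeneous k a).mul (hT g hg))]
    split_ifs with h
    · exact Submodule.subset_span ⟨g, hg, k, _, by omega,
        homogeneousComponent_isHomogeneous k a, mul_comm _ _⟩
    · exact Submodule.zero_mem _
  | zero => simp
  | add x y _ _ hx hy =>
    intro a
    rw [mul_add, map_add]
    exact Submodule.add_mem _ (hx a) (hy a)
  | smul b x _ hx =>
    intro a
    rw [smul_eq_mul, ← mul_assoc]
    exact hx _

theorem homogeneousComponent_mem_span {σ : Type*} {T : Set (MvPolynomial σ K)} {e : ℕ}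
    (hT : ∀ g ∈ T, g.IsHomogeneous e) {f : MvPolynomial σ K} (hf : f ∈ Ideal.span T) (d : ℕ) :
    homogeneousComponent d f ∈ Ideal.span T :=
  letI := MvPolynomial.gradedAlgebra (σ := σ) (R := K)
  homogeneousComponent_mem_of_mem
    (Ideal.homogeneous_span _ _ fun g hg => ⟨e, hT g hg⟩) hf d

open scoped Pointwise in
theorem isHomogeneous_of_mem_set_pow {σ : Type*} {T : Set (MvPolynomial σ K)} {e : ℕ}
    (hT : ∀ g ∈ T, g.IsHomogeneous e) (a : ℕ) : ∀ g ∈ T ^ a, g.IsHomogeneous (e * a) := by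
  induction a with
  | zero =>
    intro g hg
    rw [pow_zero, Set.mem_one] at hg
    subst hg
    simpa using isHomogeneous_one σ K
  | succ a ih =>
    intro g hg
    rw [pow_succ] at hg
    obtain ⟨x, hx, y, hy, rfl⟩ := Set.mem_mul.1 hg
    exact (ih x hx).mul (hT y hy)

end PointIdeal

section PowerContainment

variable {K : Type} [Field K] {n : ℕ}

/-- Forms `e j` of degree `t` separating the points `v j`, and linear forms `lam j` vanishing at
`v j` and at no other point of the family. -/
structure IsSeparating (v : Fin n → Fin 4 → K) (t : ℕ) (e lam : Fin n → MvPolynomial (Fin 4) K) :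
    Prop where
  zero_ne : ∀ j, v j 0 ≠ 0
  sep_hom : ∀ j, (e j).IsHomogeneous t
  sep_self : ∀ j, eval (v j) (e j) ≠ 0
  sep_ne : ∀ i j, i ≠ j → eval (v i) (e j) = 0
  lin_hom : ∀ j, (lam j).IsHomogeneous 1
  lin_self : ∀ j, eval (v j) (lam j) = 0
  lin_ne : ∀ i j, i ≠ j → eval (v i) (lam j) ≠ 0

/-- The ideal generated by the forms of degree `s` vanishing at all points of the family. -/
def formsIdeal (v : Fin n → Fin 4 → K) (s : ℕ) : Ideal (MvPolynomial (Fin 4) K) :=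
  Ideal.span {f | f.IsHomogeneous s ∧ ∀ j, eval (v j) f = 0}

theorem mem_formsIdeal {v : Fin n → Fin 4 → K} {s : ℕ} {f : MvPolynomial (Fin 4) K}
    (hf : f.IsHomogeneous s) (h : ∀ j, eval (v j) f = 0) : f ∈ formsIdeal v s :=
  Ideal.subset_span ⟨hf, h⟩

theorem formsIdeal_le_pointIdeal {v : Fin n → Fin 4 → K} {s : ℕ} (hv : ∀ j, v j 0 ≠ 0)
    (j : Fin n) : formsIdeal v s ≤ pointIdeal K (v j) :=
  Ideal.span_le.2 fun _ hg => mem_pointIdeal_of_isHomogeneous (hv j) hg.1 (hg.2 j)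

open scoped Pointwise in
theorem pointIdeal_pow_eq_span (v : Fin 4 → K) (a : ℕ) :
    pointIdeal K v ^ a = Ideal.span ({f | f.IsHomogeneous 1 ∧ eval v f = 0} ^ a) := by
  rw [pointIdeal, Ideal.span, Submodule.span_pow]

open scoped Pointwise in
theorem formsIdeal_pow_eq_span (v : Fin n → Fin 4 → K) (s a : ℕ) :
    formsIdeal v s ^ a =
      Ideal.span ({f | f.IsHomogeneous s ∧ ∀ j, eval (v j) f = 0} ^ a) := by
  rw [formsIdeal, Ideal.span, Submodule.span_pow]

/-- A form not vanishing at `v` is invertible modulo any power of the ideal of `v`,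
with control on degrees. -/
theorem exists_mul_sub_mem_pointIdeal_pow {v : Fin 4 → K} (hv : v 0 ≠ 0)
    {u : MvPolynomial (Fin 4) K} {c k : ℕ} (hu : u.IsHomogeneous c) (hu0 : eval v u ≠ 0)
    {f : MvPolynomial (Fin 4) K} (hf : f.IsHomogeneous (c + k)) {a : ℕ} (ha : a ≤ k + 1) :
    ∃ b : MvPolynomial (Fin 4) K, b.IsHomogeneous k ∧ u * b - f ∈ pointIdeal K v ^ a := by
  induction a with
  | zero => exact ⟨0, isHomogeneous_zero _ _ _, by simp⟩
  | succ a ih =>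
    obtain ⟨b, hb, hbf⟩ := ih (by omega)
    suffices H : ∃ b' : MvPolynomial (Fin 4) K, b'.IsHomogeneous k ∧
        u * b' - (u * b - f) ∈ pointIdeal K v ^ (a + 1) by
      obtain ⟨b', hb', h⟩ := H
      refine ⟨b - b', hb.sub hb', ?_⟩
      have := neg_mem h
      rwa [show -(u * b' - (u * b - f)) = u * (b - b') - f by ring] at this
    have hy : (u * b - f).IsHomogeneous (c + k) := (hu.mul hb).sub hf
    have hlin := isHomogeneous_of_mem_set_pow
      (T := {f : MvPolynomial (Fin 4) K | f.IsHomogeneous 1 ∧ eval v f = 0}) (e := 1)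
      (fun g hg => hg.1) a
    rw [pointIdeal_pow_eq_span] at hbf
    have hspan := mem_span_mul_of_isHomogeneous hlin hbf hy
    generalize u * b - f = y at hspan
    clear hbf hy
    induction hspan using Submodule.span_induction with
    | mem x hx =>
      obtain ⟨g, hg, l, h, hl, hh, rfl⟩ := hx
      have hgp : g ∈ pointIdeal K v ^ a := by
        rw [pointIdeal_pow_eq_span]
        exact Ideal.subset_span hg
      refine ⟨g * (C (eval v h / (eval v u * v 0 ^ (k - a))) * X 0 ^ (k - a)), ?_, ?_⟩
      · convert! (hlin g hg).mul (isHomogeneous_C_mul_X_pow _ 0 (k - a)) using 1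
        omega
      · rw [show u * (g * (C (eval v h / (eval v u * v 0 ^ (k - a))) * X 0 ^ (k - a))) - g * h =
          g * (u * (C (eval v h / (eval v u * v 0 ^ (k - a))) * X 0 ^ (k - a)) - h) by ring,
          pow_succ]
        refine Ideal.mul_mem_mul hgp (mem_pointIdeal_of_isHomogeneous hv (d := l) ?_ ?_)
        · refine IsHomogeneous.sub ?_ hh
          convert! hu.mul (isHomogeneous_C_mul_X_pow _ 0 (k - a)) using 1
          omega
        · simp only [map_sub, map_mul, eval_C, map_pow, eval_X]
          field_simp
          simp
    | zero => exact ⟨0, isHomogeneous_zero _ _ _, by simp⟩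
    | add x y _ _ hx hy =>
      obtain ⟨b₁, h₁, h₁'⟩ := hx
      obtain ⟨b₂, h₂, h₂'⟩ := hy
      refine ⟨b₁ + b₂, h₁.add h₂, ?_⟩
      rw [show u * (b₁ + b₂) - (x + y) = (u * b₁ - x) + (u * b₂ - y) by ring]
      exact add_mem h₁' h₂'
    | smul r x _ hx =>
      obtain ⟨b₁, h₁, h₁'⟩ := hx
      refine ⟨C r * b₁, h₁.C_mul r, ?_⟩
      rw [smul_eq_C_mul, show u * (C r * b₁) - C r * x = C r * (u * b₁ - x) by ring]
      exact Ideal.mul_mem_left _ _ h₁'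

variable {v : Fin n → Fin 4 → K} {t : ℕ} {e lam : Fin n → MvPolynomial (Fin 4) K}

theorem IsSeparating.sep_mem (hs : IsSeparating v t e lam) {i j : Fin n} (hij : i ≠ j) :
    e j ∈ pointIdeal K (v i) :=
  mem_pointIdeal_of_isHomogeneous (hs.zero_ne i) (hs.sep_hom j) (hs.sep_ne i j hij)

theorem IsSeparating.sep_mul_mem (hs : IsSeparating v t e lam) {j : Fin n}
    {y : MvPolynomial (Fin 4) K} (hy : y.IsHomogeneous 1) (hy0 : eval (v j) y = 0) :
    e j * y ∈ formsIdeal v (t + 1) := by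
  refine mem_formsIdeal ((hs.sep_hom j).mul hy) fun i => ?_
  by_cases hij : i = j
  · subst hij; simp [hy0]
  · simp [hs.sep_ne i j hij]

theorem IsSeparating.exists_lin_mul_sub_mem (hs : IsSeparating v t e lam) (j : Fin n) {k : ℕ}
    {f : MvPolynomial (Fin 4) K} (hf : f.IsHomogeneous ((k + 1) * t + k + 1)) :
    ∃ c : MvPolynomial (Fin 4) K, c.IsHomogeneous ((k + 1) * t + k) ∧
      c ∈ pointIdeal K (v j) ^ (k + 1) ∧
      ∀ i, i ≠ j → lam j * c - f ∈ pointIdeal K (v i) ^ (k + 1) := by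
  have H : ∀ i, ∃ b : MvPolynomial (Fin 4) K, b.IsHomogeneous k ∧
      (i ≠ j → (lam j * e i ^ (k + 1)) * b - f ∈ pointIdeal K (v i) ^ (k + 1)) := by
    intro i
    by_cases hij : i = j
    · exact ⟨0, isHomogeneous_zero _ _ _, fun h => absurd hij h⟩
    · have hu : (lam j * e i ^ (k + 1)).IsHomogeneous (1 + t * (k + 1)) :=
        (hs.lin_hom j).mul ((hs.sep_hom i).pow _)
      obtain ⟨b, hb, hb'⟩ := exists_mul_sub_mem_pointIdeal_pow (hs.zero_ne i) hu (k := k)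
        (by simpa using ⟨hs.lin_ne i j hij, fun h => absurd h (hs.sep_self i)⟩)
        (by convert! hf using 1; ring) le_rfl
      exact ⟨b, hb, fun _ => hb'⟩
  choose b hb hb' using H
  refine ⟨∑ i ∈ Finset.univ.erase j, e i ^ (k + 1) * b i, ?_, ?_, ?_⟩
  · refine IsHomogeneous.sum _ _ _ fun i _ => ?_
    convert! ((hs.sep_hom i).pow (k + 1)).mul (hb i) using 1
    ring
  · refine sum_mem fun i hi => Ideal.mul_mem_right _ _ (Ideal.pow_mem_pow (hs.sep_mem ?_) _)
    exact (Finset.ne_of_mem_erase hi).symm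
  · intro i hij
    rw [← Finset.add_sum_erase _ _ (Finset.mem_erase.2 ⟨hij, Finset.mem_univ i⟩), mul_add,
      add_sub_right_comm, ← mul_assoc]
    refine add_mem (hb' i hij) (Ideal.mul_mem_left _ _ (sum_mem fun l hl =>
      Ideal.mul_mem_right _ _ (Ideal.pow_mem_pow (hs.sep_mem ?_) _)))
    exact (Finset.ne_of_mem_erase hl).symm

open scoped Pointwise in
theorem IsSeparating.sep_mul_mem_pow (hs : IsSeparating v t e lam) (j : Fin n) {k : ℕ}
    (ih : ∀ f : MvPolynomial (Fin 4) K, f.IsHomogeneous ((k + 1) * (t + 1)) →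
      (∀ i, f ∈ pointIdeal K (v i) ^ (k + 1)) → f ∈ formsIdeal v (t + 1) ^ (k + 1))
    {p : MvPolynomial (Fin 4) K} (hp : p.IsHomogeneous ((k + 1) * (t + 1)))
    (hpi : ∀ i, p ∈ pointIdeal K (v i) ^ (k + 1)) (hpj : p ∈ pointIdeal K (v j) ^ (k + 2)) :
    X 0 * e j * p ∈ formsIdeal v (t + 1) ^ (k + 2) := by
  have H : ∃ D : MvPolynomial (Fin 4) K, D.IsHomogeneous ((k + 1) * (t + 1)) ∧
      D ∈ pointIdeal K (v j) ^ (k + 1) ∧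
      (∀ i, X 0 * p - lam j * D ∈ pointIdeal K (v i) ^ (k + 1)) ∧
      X 0 * e j * p - e j * lam j * D ∈ formsIdeal v (t + 1) ^ (k + 2) := by
    have hlin := isHomogeneous_of_mem_set_pow
      (T := {f : MvPolynomial (Fin 4) K | f.IsHomogeneous 1 ∧ eval (v j) f = 0}) (e := 1)
      (fun g hg => hg.1)
    rw [pointIdeal_pow_eq_span] at hpj
    have hspan := mem_span_mul_of_isHomogeneous (hlin (k + 2)) hpj hp
    clear hpj hp hpi
    induction hspan using Submodule.span_induction with
    | mem x hx =>
      obtain ⟨g, hg, l, h, hl, hh, rfl⟩ := hx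
      rw [pow_succ'] at hg
      obtain ⟨y, ⟨hy, hy0⟩, z, hz, rfl⟩ := Set.mem_mul.1 hg
      have hzj : z ∈ pointIdeal K (v j) ^ (k + 1) := by
        rw [pointIdeal_pow_eq_span]
        exact Ideal.subset_span hz
      have hl' : k + 1 + l + 1 = (k + 1) * t + k + 1 := by linarith
      have hq : (z * h).IsHomogeneous (k + 1 + l) := by simpa using (hlin (k + 1) z hz).mul hh
      have hf : (X 0 * (z * h)).IsHomogeneous ((k + 1) * t + k + 1) := by
        rw [← hl', add_comm _ 1]
        exact (isHomogeneous_X K 0).mul hq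
      obtain ⟨c, hc, hcj, hci⟩ := hs.exists_lin_mul_sub_mem j hf
      have hqi : ∀ i, X 0 * (z * h) - lam j * c ∈ pointIdeal K (v i) ^ (k + 1) := by
        intro i
        by_cases hij : i = j
        · subst hij
          exact sub_mem (Ideal.mul_mem_left _ _ (Ideal.mul_mem_right _ _ hzj))
            (Ideal.mul_mem_left _ _ hcj)
        · rw [← neg_sub]
          exact neg_mem (hci i hij)
      refine ⟨y * c, ?_, Ideal.mul_mem_left _ _ hcj, fun i => ?_, ?_⟩
      · convert! hy.mul hc using 1
        ring
      · rw [show X 0 * (y * z * h) - lam j * (y * c) = y * (X 0 * (z * h) - lam j * c) by ring]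
        exact Ideal.mul_mem_left _ _ (hqi i)
      · rw [show X 0 * e j * (y * z * h) - e j * lam j * (y * c) =
          e j * y * (X 0 * (z * h) - lam j * c) by ring, pow_succ' _ (k + 1)]
        refine Ideal.mul_mem_mul (hs.sep_mul_mem hy hy0) (ih _ ?_ hqi)
        have h1 : (lam j * c).IsHomogeneous ((k + 1) * t + k + 1) := by
          convert! (hs.lin_hom j).mul hc using 1
          ring
        convert! hf.sub h1 using 1
    | zero => exact ⟨0, isHomogeneous_zero _ _ _, by simp, by simp, by simp⟩
    | add x y _ _ hx hy =>
      obtain ⟨b₁, h₁, h₁j, h₁i, h₁'⟩ := hx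
      obtain ⟨b₂, h₂, h₂j, h₂i, h₂'⟩ := hy
      refine ⟨b₁ + b₂, h₁.add h₂, add_mem h₁j h₂j, fun i => ?_, ?_⟩
      · convert! add_mem (h₁i i) (h₂i i) using 1
        ring
      · convert! add_mem h₁' h₂' using 1
        ring
    | smul r x _ hx =>
      obtain ⟨b₁, h₁, h₁j, h₁i, h₁'⟩ := hx
      refine ⟨C r * b₁, h₁.C_mul r, Ideal.mul_mem_left _ _ h₁j, fun i => ?_, ?_⟩
      · convert! Ideal.mul_mem_left _ (C r) (h₁i i) using 1
        rw [smul_eq_C_mul]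
        ring
      · convert! Ideal.mul_mem_left _ (C r) h₁' using 1
        rw [smul_eq_C_mul]
        ring
  obtain ⟨D, hD, hDj, hDi, hDJ⟩ := H
  have hDmem : D ∈ formsIdeal v (t + 1) ^ (k + 1) := by
    refine ih D hD fun i => ?_
    by_cases hij : i = j
    · exact hij ▸ hDj
    · refine mem_pointIdeal_pow_of_mul_mem (hs.zero_ne i) (hs.lin_ne i j hij) ?_
      have := sub_mem (Ideal.mul_mem_left _ (X 0) (hpi i)) (hDi i)
      rwa [sub_sub_cancel] at this
  have h2 : e j * lam j * D ∈ formsIdeal v (t + 1) ^ (k + 2) := by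
    rw [pow_succ' _ (k + 1)]
    exact Ideal.mul_mem_mul (hs.sep_mul_mem (hs.lin_hom j) (hs.lin_self j)) hDmem
  have := add_mem hDJ h2
  rwa [sub_add_cancel] at this

/-- Modulo the forms of degree `t + 1` through the points, every form of larger degree is a
combination of the separating forms. -/
theorem IsSeparating.exists_sub_sum_mem (hs : IsSeparating v t e lam) (d : ℕ)
    {h : MvPolynomial (Fin 4) K} (hh : h.IsHomogeneous (t + 1 + d)) :
    ∃ a : Fin n → K, h - ∑ j, C (a j) * (e j * X 0 ^ (d + 1)) ∈ formsIdeal v (t + 1) := by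
  induction d generalizing h with
  | zero =>
    refine ⟨fun j => eval (v j) h / (eval (v j) (e j) * v j 0), mem_formsIdeal ?_ fun i => ?_⟩
    · refine hh.sub (IsHomogeneous.sum _ _ _ fun j _ => IsHomogeneous.C_mul ?_ _)
      exact (hs.sep_hom j).mul (isHomogeneous_X_pow _ _)
    · have := hs.sep_self i
      have := hs.zero_ne i
      rw [map_sub, map_sum, Finset.sum_eq_single i]
      · simp
        field_simp
        simp
      · intro j _ hj
        simp [hs.sep_ne i j hj.symm]
      · simp
  | succ d ih =>
    have hX : h ∈ Ideal.span (Set.range (X : Fin 4 → MvPolynomial (Fin 4) K)) := by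
      rw [← pow_one (Ideal.span _), mem_pow_idealOfVars_iff']
      intro x hx
      exact hh.coeff_eq_zero (by omega)
    have hspan := mem_span_mul_of_isHomogeneous (T := Set.range X) (e := 1)
      (by rintro _ ⟨i, rfl⟩; exact isHomogeneous_X K i) hX hh
    clear hX hh
    induction hspan using Submodule.span_induction with
    | mem x hx =>
      obtain ⟨_, ⟨i, rfl⟩, l, h, hl, hh, rfl⟩ := hx
      obtain ⟨a, ha⟩ := ih (h := h) (by convert! hh using 1; omega)
      refine ⟨fun j => a j * (v j i / v j 0), ?_⟩
      have h1 : ∀ j, e j * (X i - C (v j i / v j 0) * X 0) ∈ formsIdeal v (t + 1) := by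
        intro j
        have := hs.zero_ne j
        refine hs.sep_mul_mem ((isHomogeneous_X K i).sub (isHomogeneous_C_mul_X _ 0)) ?_
        simp
        field_simp
        simp
      have h2 := add_mem (Ideal.mul_mem_left _ (X i) ha)
        (sum_mem (t := Finset.univ) fun j _ => Ideal.mul_mem_left _ (C (a j) * X 0 ^ (d + 1))
          (h1 j))
      convert! h2 using 1
      rw [mul_sub, Finset.mul_sum, sub_add, ← Finset.sum_sub_distrib]
      congr 1
      refine Finset.sum_congr rfl fun j _ => ?_
      rw [C_mul]
      ring
    | zero => exact ⟨0, by simp⟩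
    | add x y _ _ hx hy =>
      obtain ⟨a, ha⟩ := hx
      obtain ⟨b, hb⟩ := hy
      refine ⟨a + b, ?_⟩
      convert! add_mem ha hb using 1
      simp only [Pi.add_apply, C_add, add_mul, Finset.sum_add_distrib]
      ring
    | smul r x _ hx =>
      obtain ⟨a, ha⟩ := hx
      refine ⟨r • a, ?_⟩
      convert! Ideal.mul_mem_left _ (C r) ha using 1
      rw [smul_eq_C_mul, mul_sub, Finset.mul_sum]
      refine congrArg₂ (· - ·) rfl (Finset.sum_congr rfl fun j _ => ?_)
      rw [Pi.smul_apply, smul_eq_mul, C_mul]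
      ring

/-- If forms of degree `t` separate the points, then the `r`-th symbolic power of their ideal
agrees with the ordinary power in degrees at least `r * (t + 1)`. -/
theorem IsSeparating.mem_formsIdeal_pow (hs : IsSeparating v t e lam) (r d : ℕ)
    {f : MvPolynomial (Fin 4) K} (hf : f.IsHomogeneous (r * (t + 1) + d))
    (hfi : ∀ i, f ∈ pointIdeal K (v i) ^ r) : f ∈ formsIdeal v (t + 1) ^ r := by
  induction r generalizing d f with
  | zero => simp
  | succ r ih =>
    have hfr : f ∈ formsIdeal v (t + 1) ^ r :=
      ih (t + 1 + d) (by convert! hf using 1; ring)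
        fun i => Ideal.pow_le_pow_right (Nat.le_succ r) (hfi i)
    have H : ∃ p : Fin n → MvPolynomial (Fin 4) K, (∀ j, (p j).IsHomogeneous (r * (t + 1))) ∧
        (∀ j, p j ∈ formsIdeal v (t + 1) ^ r) ∧
        f - ∑ j, e j * X 0 ^ (d + 1) * p j ∈ formsIdeal v (t + 1) ^ (r + 1) := by
      have hgen := isHomogeneous_of_mem_set_pow
        (T := {f : MvPolynomial (Fin 4) K | f.IsHomogeneous (t + 1) ∧ ∀ j, eval (v j) f = 0})
        (e := t + 1) (fun g hg => hg.1) r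
      rw [formsIdeal_pow_eq_span] at hfr
      have hspan := mem_span_mul_of_isHomogeneous hgen hfr hf
      clear hfr hf hfi
      induction hspan using Submodule.span_induction with
      | mem x hx =>
        obtain ⟨g, hg, l, h, hl, hh, rfl⟩ := hx
        have hgr : g ∈ formsIdeal v (t + 1) ^ r := by
          rw [formsIdeal_pow_eq_span]
          exact Ideal.subset_span hg
        obtain ⟨a, ha⟩ := hs.exists_sub_sum_mem d (h := h) (by convert! hh using 1; linarith)
        refine ⟨fun j => C (a j) * g, fun j => ?_, fun j => Ideal.mul_mem_left _ _ hgr, ?_⟩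
        · rw [mul_comm r]
          exact (hgen g hg).C_mul _
        · rw [pow_succ]
          convert! Ideal.mul_mem_mul hgr ha using 1
          rw [mul_sub, Finset.mul_sum]
          congr 1
          exact Finset.sum_congr rfl fun j _ => by ring
      | zero => exact ⟨0, fun _ => isHomogeneous_zero _ _ _, by simp, by simp⟩
      | add x y _ _ hx hy =>
        obtain ⟨p, hp, hp', hpx⟩ := hx
        obtain ⟨q, hq, hq', hqy⟩ := hy
        refine ⟨p + q, fun j => (hp j).add (hq j), fun j => add_mem (hp' j) (hq' j), ?_⟩
        convert! add_mem hpx hqy using 1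
        simp only [Pi.add_apply, mul_add, Finset.sum_add_distrib]
        ring
      | smul b x _ hx =>
        obtain ⟨p, hp, hp', hpx⟩ := hx
        refine ⟨fun j => C b * p j, fun j => (hp j).C_mul b,
          fun j => Ideal.mul_mem_left _ _ (hp' j), ?_⟩
        convert! Ideal.mul_mem_left _ (C b) hpx using 1
        rw [smul_eq_C_mul, mul_sub, Finset.mul_sum]
        congr 1
        exact Finset.sum_congr rfl fun j _ => by ring
    obtain ⟨p, hp, hpr, hfp⟩ := H
    have hle : ∀ (a : ℕ) (j : Fin n), formsIdeal v (t + 1) ^ a ≤ pointIdeal K (v j) ^ a :=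
      fun a j => Ideal.pow_right_mono (formsIdeal_le_pointIdeal hs.zero_ne j) a
    have hpj : ∀ j, p j ∈ pointIdeal K (v j) ^ (r + 1) := by
      intro j
      refine mem_pointIdeal_pow_of_mul_mem (hs.zero_ne j) (u := e j * X 0 ^ (d + 1)) ?_ ?_
      · simpa using ⟨hs.sep_self j, fun h => absurd h (hs.zero_ne j)⟩
      · have h1 := sub_mem (hfi j) (hle _ j hfp)
        rw [sub_sub_cancel, ← Finset.add_sum_erase _ _ (Finset.mem_univ j)] at h1
        refine (Submodule.add_mem_iff_left _ (sum_mem fun i hi => ?_)).1 h1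
        rw [pow_succ']
        exact Ideal.mul_mem_mul
          (Ideal.mul_mem_right _ _ (hs.sep_mem (Finset.ne_of_mem_erase hi).symm)) (hle r j (hpr i))
    have hterm : ∀ j, e j * X 0 ^ (d + 1) * p j ∈ formsIdeal v (t + 1) ^ (r + 1) := by
      intro j
      rw [show e j * X 0 ^ (d + 1) * p j = X 0 ^ d * (X 0 * e j * p j) by ring]
      refine Ideal.mul_mem_left _ _ ?_
      cases r with
      | zero =>
        have h0 := hp j
        rw [zero_mul, ← totalDegree_zero_iff_isHomogeneous, totalDegree_eq_zero_iff_eq_C] at h0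
        have h1 := eval_eq_zero_of_mem_pointIdeal (pow_one (pointIdeal K (v j)) ▸ hpj j)
        rw [h0, eval_C] at h1
        rw [h0, h1]
        simp
      | succ k =>
        exact hs.sep_mul_mem_pow j (fun g hg => ih 0 hg) (hp j) (fun i => hle _ i (hpr j)) (hpj j)
    have := add_mem hfp (sum_mem (t := Finset.univ) fun j _ => hterm j)
    rwa [sub_add_cancel] at this

end PowerContainment

section VanishingBound

variable {K : Type} [Field K]

/-- Translation of a polynomial by the vector `p`, moving the point `p` to the origin. -/
def translateVars {σ : Type*} (p : σ → K) : MvPolynomial σ K →ₐ[K] MvPolynomial σ K :=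
  aeval fun i => X i + C (p i)

/-- The total order of vanishing of a nonzero polynomial along the points `x i` is at most
`b` times its degree. Points may be repeated. -/
def VanishingBound {N : ℕ} (b : ℕ) {ι : Type} [Fintype ι] (x : ι → Fin N → K) : Prop :=
  ∀ f : MvPolynomial (Fin N) K, f ≠ 0 → ∀ e : ι → ℕ,
    (∀ i, translateVars (x i) f ∈ idealOfVars (Fin N) K ^ e i) → ∑ i, e i ≤ b * f.totalDegree

theorem mem_pow_idealOfVars_of_X_mul_mem {σ : Type*} {f : MvPolynomial σ K} {i : σ} {a : ℕ}
    (h : X i * f ∈ idealOfVars σ K ^ a) : f ∈ idealOfVars σ K ^ (a - 1) := by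
  classical
  rw [mem_pow_idealOfVars_iff'] at h ⊢
  intro x hx
  rw [← coeff_X_mul x i f]
  refine h _ ?_
  rw [map_add, Finsupp.degree_single]
  omega

theorem totalDegree_aeval_le {σ τ : Type*} (g : σ → MvPolynomial τ K)
    (hg : ∀ i, (g i).totalDegree ≤ 1) (f : MvPolynomial σ K) :
    (aeval g f).totalDegree ≤ f.totalDegree := by
  rw [aeval_def, eval₂_eq]
  refine totalDegree_finsetSum_le fun d hd => ?_
  refine (totalDegree_mul _ _).trans ?_
  rw [MvPolynomial.algebraMap_eq, totalDegree_C, zero_add]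
  refine (totalDegree_finsetProd _ _).trans ((Finset.sum_le_sum fun i _ => ?_).trans
    (le_totalDegree hd))
  exact (totalDegree_pow _ _).trans (by simpa using Nat.mul_le_mul_left (d i) (hg i))

/-- Substitution of the constant `a` for the first variable. -/
def restrictHead {N : ℕ} (a : K) : MvPolynomial (Fin (N + 1)) K →ₐ[K] MvPolynomial (Fin N) K :=
  aeval (Fin.cons (C a) X)

theorem dvd_of_restrictHead_eq_zero {N : ℕ} {a : K} {f : MvPolynomial (Fin (N + 1)) K}
    (h : restrictHead a f = 0) : X 0 - C a ∣ f := by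
  rw [← Ideal.mem_span_singleton, ← Ideal.Quotient.eq_zero_iff_mem]
  have key : (Ideal.Quotient.mkₐ K (Ideal.span {X 0 - C a})) =
      ((Ideal.Quotient.mkₐ K (Ideal.span {X 0 - C a})).comp (rename Fin.succ)).comp
        (restrictHead (N := N) a) := by
    ext i
    refine Fin.cases ?_ (fun i => ?_) i
    · simp only [restrictHead, AlgHom.comp_apply, aeval_X, Fin.cons_zero, rename_C]
      exact Ideal.Quotient.eq.2 (Ideal.mem_span_singleton_self _)
    · simp [restrictHead]
  have := congrArg (fun φ => φ f) key
  simpa [h] using this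

theorem translateVars_restrictHead {N : ℕ} (a : K) (x : Fin N → K)
    (f : MvPolynomial (Fin (N + 1)) K) :
    translateVars x (restrictHead a f) =
      restrictHead 0 (translateVars (Fin.cons a x : Fin (N + 1) → K) f) := by
  have key : (translateVars x).comp (restrictHead a) =
      (restrictHead 0).comp (translateVars (Fin.cons a x : Fin (N + 1) → K)) := by
    ext i
    refine Fin.cases ?_ (fun i => ?_) i <;> simp [restrictHead, translateVars]
  exact congrArg (fun φ => φ f) key

theorem map_restrictHead_idealOfVars_le {N : ℕ} :
    (idealOfVars (Fin (N + 1)) K).map (restrictHead (N := N) (0 : K)) ≤ idealOfVars (Fin N) K := by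
  rw [Ideal.map_le_iff_le_comap, Ideal.span_le]
  rintro _ ⟨i, rfl⟩
  refine Fin.cases ?_ (fun i => ?_) i
  · simp [restrictHead]
  · simpa [restrictHead] using
      Ideal.subset_span (Set.mem_range_self (f := (X : Fin N → MvPolynomial (Fin N) K)) i)

theorem translateVars_mem_of_restrictHead {N : ℕ} {a : K} {x : Fin N → K} {e : ℕ}
    {f : MvPolynomial (Fin (N + 1)) K}
    (h : translateVars (Fin.cons a x : Fin (N + 1) → K) f ∈ idealOfVars _ K ^ e) :
    translateVars x (restrictHead a f) ∈ idealOfVars (Fin N) K ^ e := by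
  rw [translateVars_restrictHead]
  exact Ideal.pow_right_mono map_restrictHead_idealOfVars_le e
    (Ideal.map_pow (restrictHead (N := N) (0 : K)) _ e ▸ Ideal.mem_map_of_mem _ h)

theorem totalDegree_X_sub_C {N : ℕ} (a : K) :
    (X 0 - C a : MvPolynomial (Fin (N + 1)) K).totalDegree = 1 := by
  rw [sub_eq_add_neg, ← C_neg, totalDegree_add_eq_left_of_totalDegree_lt] <;> simp

theorem vanishingBound_zero {ι : Type} [Fintype ι] (x : ι → Fin 0 → K) :
    VanishingBound 0 x := by
  intro f hf e h
  have : ∀ i, e i = 0 := by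
    intro i
    by_contra hi
    refine hf ?_
    have h1 := h i
    rw [mem_pow_idealOfVars_iff'] at h1
    have h2 := h1 0 (by simpa using Nat.pos_of_ne_zero hi)
    have h3 := eq_C_of_isEmpty f
    rw [h3, translateVars, algHom_C] at h2
    rw [h3]
    simpa using h2
  simp [this]

/-- Passing from parallel hyperplanes to the ambient space. -/
theorem VanishingBound.sigma {N : ℕ} {c b : ℕ} {A : Type} [Fintype A] {a : A → K}
    (ha : Function.Injective a) {ι : A → Type} [∀ α, Fintype (ι α)]
    {x : ∀ α, ι α → Fin N → K} (h : ∀ α, VanishingBound c (x α))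
    (hc : Fintype.card A * c ≤ b) (hcard : ∀ α, Fintype.card (ι α) ≤ b) :
    VanishingBound b
      (fun p : Σ α, ι α => (Fin.cons (a p.1) (x p.1 p.2) : Fin (N + 1) → K)) := by
  classical
  intro f hf e he
  induction hd : f.totalDegree using Nat.strong_induction_on generalizing f e with
  | _ d ih =>
  by_cases hex : ∀ α, restrictHead (a α) f ≠ 0
  · calc ∑ p, e p = ∑ α, ∑ i, e ⟨α, i⟩ := Fintype.sum_sigma _
      _ ≤ ∑ α : A, c * d := Finset.sum_le_sum fun α _ =>
        (h α _ (hex α) _ fun i => translateVars_mem_of_restrictHead (he ⟨α, i⟩)).trans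
          (Nat.mul_le_mul_left c (hd ▸ totalDegree_aeval_le _
            (fun i => by refine Fin.cases ?_ (fun i => ?_) i <;> simp) f))
      _ = Fintype.card A * c * d := by simp [mul_assoc]
      _ ≤ b * d := Nat.mul_le_mul_right d hc
  · push Not at hex
    obtain ⟨α, hα⟩ := hex
    obtain ⟨g, rfl⟩ := dvd_of_restrictHead_eq_zero hα
    have hg : g ≠ 0 := right_ne_zero_of_mul hf
    rw [totalDegree_mul_of_isDomain (left_ne_zero_of_mul hf) hg, totalDegree_X_sub_C] at hd
    have h1 := ih g.totalDegree (by omega) g hg (fun p => if p.1 = α then e p - 1 else e p)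
      (fun p => ?_) rfl
    · have h2 : ∀ p, e p ≤ (if p.1 = α then e p - 1 else e p) + if p.1 = α then 1 else 0 := by
        intro p
        split_ifs <;> omega
      have h3 : (∑ p : Σ α, ι α, if p.1 = α then 1 else 0) = Fintype.card (ι α) := by
        rw [Fintype.sum_sigma, Finset.sum_eq_single α] <;> simp +contextual
      calc ∑ p, e p ≤ _ := Finset.sum_le_sum fun p _ => h2 p
        _ ≤ b * g.totalDegree + b := by
          rw [Finset.sum_add_distrib, h3]
          exact add_le_add h1 (hcard α)
        _ = b * d := by rw [← hd]; ring
    · have h2 := he p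
      rw [map_mul] at h2
      have h3 : translateVars (Fin.cons (a p.1) (x p.1 p.2) : Fin (N + 1) → K)
          (X 0 - C (a α)) = X 0 + C (a p.1 - a α) := by
        simp [translateVars]
        ring
      rw [h3] at h2
      split_ifs with hp
      · rw [hp, sub_self, C_0, add_zero] at h2
        exact mem_pow_idealOfVars_of_X_mul_mem h2
      · refine mem_pow_idealOfVars_of_mul_mem ?_ h2
        simpa [sub_eq_zero] using ha.ne hp

theorem VanishingBound.comp_equiv {N b : ℕ} {ι κ : Type} [Fintype ι] [Fintype κ]
    {x : ι → Fin N → K} (h : VanishingBound b x) (φ : κ ≃ ι) : VanishingBound b (x ∘ φ) := by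
  intro f hf e he
  rw [← φ.symm.sum_comp e]
  refine h f hf _ fun i => ?_
  simpa using he (φ.symm i)

variable [CharZero K]

theorem exists_vanishingBound_grid (q N : ℕ) :
    ∃ x : Fin (q ^ (N + 1)) → Fin (N + 1) → K, VanishingBound (q ^ N) x := by
  have hq : Function.Injective fun i : Fin q => ((i : ℕ) : K) :=
    Nat.cast_injective.comp Fin.val_injective
  induction N with
  | zero =>
    have h := VanishingBound.sigma hq (b := 1) (ι := fun _ => Unit) (x := fun _ _ => 0)
      (fun _ => vanishingBound_zero (K := K) _) (by simp) (by simp)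
    exact ⟨_, h.comp_equiv (Fintype.equivFinOfCardEq (by simp)).symm⟩
  | succ N ih =>
    obtain ⟨x, hx⟩ := ih
    have h := VanishingBound.sigma hq (b := q ^ (N + 1)) (fun _ => hx)
      (by simp [pow_succ']) (by simp)
    exact ⟨_, h.comp_equiv (Fintype.equivFinOfCardEq (by simp [pow_succ'])).symm⟩

/-- Points on a cubical grid impose a lower bound on the degree of polynomials
vanishing on them to high order. -/
theorem exists_grid_points (q n : ℕ) :
    ∃ p : Fin n → Fin 3 → K, ∀ (m : ℕ) (f : MvPolynomial (Fin 3) K), f ≠ 0 →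
      (∀ j, translateVars (p j) f ∈ idealOfVars (Fin 3) K ^ m) →
      m * min n (q ^ 3) ≤ q ^ 2 * f.totalDegree := by
  obtain ⟨x, hx⟩ := exists_vanishingBound_grid (K := K) q 2
  refine ⟨fun j => if h : (j : ℕ) < q ^ 3 then x ⟨j, h⟩ else 0, fun m f hf h => ?_⟩
  have h1 := hx f hf (fun i => if (i : ℕ) < n then m else 0) fun i => ?_
  · refine le_trans (le_of_eq ?_) h1
    rw [← Finset.sum_filter, Finset.sum_const, smul_eq_mul, mul_comm]
    congr 1
    rw [Fin.card_filter_val_lt, min_comm]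
  · split_ifs with hi
    · simpa using h ⟨i, hi⟩
    · simp

/-- Five points, four of them on a plane: the fifth one may be counted twice. -/
theorem exists_five_points {n : ℕ} (hn : 5 ≤ n) :
    ∃ p : Fin n → Fin 3 → K, ∀ (m : ℕ) (f : MvPolynomial (Fin 3) K), f ≠ 0 →
      (∀ j, translateVars (p j) f ∈ idealOfVars (Fin 3) K ^ m) →
      m * 6 ≤ 4 * f.totalDegree := by
  obtain ⟨x, hx⟩ := exists_vanishingBound_grid (K := K) 2 1
  have hinj : Function.Injective fun _ : Unit => (0 : K) := fun _ _ _ => rfl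
  have h1 := VanishingBound.sigma hinj (b := 2) (ι := fun _ => Fin 2) (x := fun _ _ => 0)
    (fun _ => vanishingBound_zero (K := K) _) (by simp) (by simp)
  have h2 := VanishingBound.sigma hinj (b := 2) (ι := fun _ => Fin 2)
    (fun _ => h1.comp_equiv (Fintype.equivFinOfCardEq (n := 2) (by simp)).symm) (by simp) (by simp)
  have h2' := h2.comp_equiv (Fintype.equivFinOfCardEq (n := 2) (by simp)).symm
  have h3 := VanishingBound.sigma (A := Bool) (a := fun b => if b then (1 : K) else 0)
    (by intro b c; cases b <;> cases c <;> simp) (b := 4) (c := 2)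
    (ι := fun b => Fin (bif b then 4 else 2))
    (x := fun b => match b with
      | true => x
      | false => _) (by
      intro b
      cases b
      · exact h2'
      · exact hx) (by simp) (by intro b; cases b <;> simp)
  refine ⟨fun j => if h : (j : ℕ) < 4 then (Fin.cons 1 (x ⟨j, h⟩) : Fin 3 → K) else 0,
    fun m f hf h => ?_⟩
  have h4 := h3 f hf (fun _ => m) ?_
  · simpa [Fintype.sum_sigma, mul_comm] using h4
  · rintro ⟨b, i⟩
    cases b
    · have h5 := h ⟨4, by omega⟩
      simp only [Nat.lt_irrefl, dite_false] at h5
      convert! h5 using 3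
      ext k
      fin_cases k <;> simp
    · have hi : (i : ℕ) < 4 := i.2
      have h5 := h ⟨i, by omega⟩
      simp only [hi, dite_true] at h5
      simpa using h5

end VanishingBound

section SpecialPoints

theorem six_mul_choose_three (t : ℕ) : 6 * (t + 2).choose 3 = t * (t + 1) * (t + 2) := by
  induction t with
  | zero => simp
  | succ t ih =>
    have h := Nat.add_one_mul_choose_eq (t + 1) 1
    rw [Nat.choose_one_right] at h
    rw [Nat.choose_succ_succ' (t + 2) 2, mul_add, ih]
    linarith [congrArg (fun z => 3 * z) h]

variable {K : Type} [Field K] [CharZero K]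

theorem exists_special_points {n r t : ℕ} (hr : 2 ≤ r) (ht : (t + 2).choose 3 < n) :
    ∃ p : Fin n → Fin 3 → K, ∀ f : MvPolynomial (Fin 3) K, f ≠ 0 →
      (∀ j, translateVars (p j) f ∈ idealOfVars (Fin 3) K ^ (3 * r - 2)) →
      r * (t + 1) ≤ f.totalDegree := by
  obtain ⟨k, rfl⟩ := Nat.exists_eq_add_of_le' hr
  rw [show 3 * (k + 2) - 2 = 3 * k + 4 by omega]
  have h6 := six_mul_choose_three t
  have hn : t * (t + 1) * (t + 2) + 6 ≤ 6 * n := by omega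
  clear h6
  by_cases ht2 : t = 2
  · subst ht2
    obtain ⟨p, hp⟩ := exists_five_points (K := K) (n := n) (by omega)
    exact ⟨p, fun f hf h => by have := hp _ f hf h; omega⟩
  · by_cases ht4 : t = 4
    · subst ht4
      obtain ⟨p, hp⟩ := exists_grid_points (K := K) 3 n
      refine ⟨p, fun f hf h => ?_⟩
      have h1 := hp _ f hf h
      have h2 : 21 ≤ min n (3 ^ 3) := by omega
      have h3 := (Nat.mul_le_mul_left (3 * k + 4) h2).trans h1
      omega
    · obtain ⟨q, hq⟩ : ∃ q, t + 1 = 2 * q ∨ t + 1 + 1 = 2 * q := ⟨(t + 2) / 2, by omega⟩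
      obtain ⟨p, hp⟩ := exists_grid_points (K := K) q n
      refine ⟨p, fun f hf h => ?_⟩
      have h1 := hp _ f hf h
      have hq0 : 0 < q := by omega
      have h2 : q ^ 2 * (t + 1) ≤ 2 * min n (q ^ 3) := by
        rw [← Nat.mul_min_mul_left, le_min_iff]
        constructor
        · obtain ⟨a, rfl⟩ := Nat.exists_eq_add_of_lt hq0
          rw [zero_add] at hq ⊢
          rcases hq with hq | hq
          · obtain rfl : t = 2 * a + 1 := by omega
            nlinarith [sq_nonneg a, Nat.zero_le (a ^ 3)]
          · obtain rfl : t = 2 * a := by omega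
            rcases Nat.eq_zero_or_pos a with rfl | ha
            · omega
            · obtain ⟨b, rfl⟩ := Nat.exists_eq_add_of_le' (show 3 ≤ a by omega)
              nlinarith [sq_nonneg b, Nat.zero_le (b ^ 3)]
        · rw [pow_succ q 2, mul_left_comm]
          exact Nat.mul_le_mul_left _ (by omega)
      have h3 : q ^ 2 * ((3 * k + 4) * (t + 1)) ≤ q ^ 2 * (2 * f.totalDegree) := by
        calc _ = (3 * k + 4) * (q ^ 2 * (t + 1)) := by ring
          _ ≤ (3 * k + 4) * (2 * min n (q ^ 3)) := Nat.mul_le_mul_left _ h2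
          _ ≤ _ := by linarith
      have h4 := Nat.le_of_mul_le_mul_left h3 (by positivity)
      nlinarith

end SpecialPoints

section GenericPolynomials

variable {K : Type} [Field K]

/-- Injectivity of a matrix with polynomial entries at one point forces injectivity generically. -/
theorem exists_eval_ne_zero_of_mulVec_injective {τ ι κ : Type*} [Fintype ι] [Fintype κ]
    (M : Matrix ι κ (MvPolynomial τ K)) (p : τ → K)
    (hp : Function.Injective (M.map (eval p)).mulVec) :
    ∃ G : MvPolynomial τ K, eval p G ≠ 0 ∧
      ∀ v : τ → K, eval v G ≠ 0 → Function.Injective (M.map (eval v)).mulVec := by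
  classical
  obtain ⟨g, hg⟩ := LinearMap.exists_leftInverse_of_injective (Matrix.toLin' (M.map (eval p)))
    (LinearMap.ker_eq_bot.2 hp)
  obtain ⟨L, hL⟩ : ∃ L : Matrix κ ι K, L * M.map (eval p) = 1 := by
    refine ⟨LinearMap.toMatrix' g, ?_⟩
    rw [← LinearMap.toMatrix'_toLin' (M.map (eval p)), ← LinearMap.toMatrix'_comp, hg,
      LinearMap.toMatrix'_id]
  let L' : Matrix κ ι (MvPolynomial τ K) := L.map C
  have key : ∀ v : τ → K, eval v (L' * M).det = (L * M.map (eval v)).det := by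
    intro v
    rw [RingHom.map_det, RingHom.mapMatrix_apply, Matrix.map_mul, Matrix.map_map]
    congr 2
    ext i j
    simp
  refine ⟨(L' * M).det, ?_, fun v hv => ?_⟩
  · simp [key, hL]
  · rw [key] at hv
    have h1 := Matrix.mulVec_injective_of_det_ne_zero hv
    have h2 : (L * M.map (eval v)).mulVec = L.mulVec ∘ (M.map (eval v)).mulVec := by
      ext1 c
      simp
    rw [h2] at h1
    exact h1.of_comp

theorem exists_generic_translateVars {n m D : ℕ} (p : Fin n → Fin 4 → K)
    (hp : ∀ f : MvPolynomial (Fin 4) K, f.IsHomogeneous D →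
      (∀ j, translateVars (p j) f ∈ idealOfVars (Fin 4) K ^ m) → f = 0) :
    ∃ G : MvPolynomial (Fin n × Fin 4) K, G ≠ 0 ∧
      ∀ v : Fin n → Fin 4 → K, eval (fun q => v q.1 q.2) G ≠ 0 →
        ∀ f : MvPolynomial (Fin 4) K, f.IsHomogeneous D →
          (∀ j, translateVars (v j) f ∈ idealOfVars (Fin 4) K ^ m) → f = 0 := by
  classical
  set B : Finset (Fin 4 →₀ ℕ) := Finset.univ.finsuppAntidiag D with hB
  set R : Finset (Fin 4 →₀ ℕ) := (Finset.range m).biUnion fun k => Finset.univ.finsuppAntidiag k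
    with hR
  have hBmem : ∀ β, β ∈ B ↔ β.degree = D := by
    intro β
    simp [hB, Finset.mem_finsuppAntidiag, Finsupp.degree_eq_sum]
  have hRmem : ∀ α, α ∈ R ↔ α.degree < m := by
    intro α
    simp [hR, Finset.mem_finsuppAntidiag, Finsupp.degree_eq_sum]
  set M : Matrix (Fin n × R) B (MvPolynomial (Fin n × Fin 4) K) := fun i β =>
    coeff i.2.1 (aeval (fun l => X l + C (X (i.1, l)) :
      Fin 4 → MvPolynomial (Fin 4) (MvPolynomial (Fin n × Fin 4) K)) (monomial β.1 (1 : K))) with hM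
  have hMv : ∀ (v : Fin n → Fin 4 → K) (i : Fin n × R) (β : B),
      eval (fun q => v q.1 q.2) (M i β) = coeff i.2.1 (translateVars (v i.1) (monomial β.1 1)) := by
    intro v i β
    rw [hM, ← coeff_map, translateVars, aeval_monomial, aeval_monomial]
    simp [Finsupp.prod]
  have hMc : ∀ (v : Fin n → Fin 4 → K) (c : B → K) (i : Fin n × R),
      (M.map (eval fun q => v q.1 q.2)).mulVec c i =
        coeff i.2.1 (translateVars (v i.1) (∑ β, c β • monomial β.1 1)) := by
    intro v c i
    simp only [Matrix.mulVec, dotProduct, Matrix.map_apply, hMv, map_sum, map_smul, coeff_sum,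
      coeff_smul, smul_eq_mul, mul_comm]
  have hsum : ∀ f : MvPolynomial (Fin 4) K, f.IsHomogeneous D →
      f = ∑ β : B, coeff β.1 f • monomial β.1 1 := by
    intro f hf
    ext d
    by_cases hd : d.degree = D
    · rw [coeff_sum, Finset.sum_eq_single ⟨d, (hBmem d).2 hd⟩]
      · simp
      · intro β _ hβ
        have : β.1 ≠ d := fun h => hβ (Subtype.ext h)
        simp [coeff_monomial, this]
      · simp
    · rw [hf.coeff_eq_zero hd, coeff_sum]
      refine (Finset.sum_eq_zero fun β _ => ?_).symm
      have : β.1 ≠ d := fun h => hd (h ▸ (hBmem _).1 β.2)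
      simp [coeff_monomial, this]
  have hinj : ∀ v : Fin n → Fin 4 → K,
      Function.Injective (M.map (eval fun q => v q.1 q.2)).mulVec ↔
      ∀ f : MvPolynomial (Fin 4) K, f.IsHomogeneous D →
        (∀ j, translateVars (v j) f ∈ idealOfVars (Fin 4) K ^ m) → f = 0 := by
    intro v
    rw [← Matrix.coe_mulVecLin, injective_iff_map_eq_zero]
    constructor
    · intro h f hf hfj
      have h0 := h (fun β : B => coeff β.1 f) (by
        ext i
        rw [Matrix.mulVecLin_apply, hMc, ← hsum f hf]
        exact (mem_pow_idealOfVars_iff' _ _).1 (hfj i.1) _ ((hRmem _).1 i.2.2))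
      rw [hsum f hf]
      exact Finset.sum_eq_zero fun β _ => by rw [congrFun h0 β]; simp
    · intro h c hc
      have h0 := h (∑ β, c β • monomial β.1 1) ?_ fun j => ?_
      · ext β
        have h1 := congrArg (coeff β.1) h0
        simpa [coeff_sum, coeff_monomial, Subtype.coe_inj] using h1
      · refine IsHomogeneous.sum _ _ _ fun β _ => ?_
        rw [smul_eq_C_mul]
        exact (isHomogeneous_monomial _ ((hBmem _).1 β.2)).C_mul _
      · rw [mem_pow_idealOfVars_iff']
        intro α hα
        have := congrFun hc (j, ⟨α, (hRmem α).2 hα⟩)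
        rwa [Matrix.mulVecLin_apply, hMc] at this
  obtain ⟨G, hG, hGv⟩ := exists_eval_ne_zero_of_mulVec_injective M _ ((hinj p).2 hp)
  exact ⟨G, fun h => hG (by rw [h, map_zero]), fun v hv => (hinj v).1 (hGv _ hv)⟩

/-- Generically, distinct monomials are linearly independent on as many points. -/
theorem det_monomial_ne_zero {n : ℕ} {β : Fin n → Fin 4 →₀ ℕ} (hβ : Function.Injective β) :
    (Matrix.of fun i k : Fin n => rename (Prod.mk i) (monomial (β k) (1 : K))).det ≠ 0 := by
  classical
  set E : Equiv.Perm (Fin n) → (Fin n × Fin 4 →₀ ℕ) := fun π =>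
    ∑ i, (β i).mapDomain (Prod.mk (π i)) with hE
  have hEapp : ∀ π i l, E π (π i, l) = β i l := by
    intro π i l
    rw [hE, Finsupp.finsetSum_apply, Finset.sum_eq_single i]
    · exact Finsupp.mapDomain_apply (Prod.mk_right_injective _) _ _
    · intro j _ hj
      refine Finsupp.mapDomain_of_notMem_range _ _ ?_
      rintro ⟨l', hl'⟩
      exact hj (π.injective (congrArg Prod.fst hl'))
    · simp
  have hEinj : ∀ π, E π = E 1 → π = 1 := by
    intro π hπ
    ext1 i
    refine hβ (Finsupp.ext fun l => ?_)
    rw [← hEapp 1 (π i) l, ← hπ]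
    exact hEapp π i l
  have hprod : ∀ π : Equiv.Perm (Fin n), ∏ i, Matrix.of (fun i k : Fin n =>
      rename (Prod.mk i) (monomial (β k) (1 : K))) (π i) i = monomial (E π) 1 := by
    intro π
    simp only [Matrix.of_apply, rename_monomial]
    exact (monomial_sum_one _ _).symm
  intro h0
  have h1 := congrArg (coeff (E 1)) h0
  rw [Matrix.det_apply, coeff_sum, Finset.sum_eq_single 1] at h1
  · rw [hprod] at h1
    simp at h1
  · intro π _ hπ
    rw [hprod, coeff_smul, coeff_monomial, if_neg fun h => hπ (hEinj π h), smul_zero]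
  · simp

theorem exists_generic_separating {n t : ℕ} (h : n ≤ (t + 3).choose 3) :
    ∃ G : MvPolynomial (Fin n × Fin 4) K, G ≠ 0 ∧
      ∀ v : Fin n → Fin 4 → K, eval (fun q => v q.1 q.2) G ≠ 0 →
        ∃ e : Fin n → MvPolynomial (Fin 4) K, (∀ j, (e j).IsHomogeneous t) ∧
          ∀ i j, eval (v i) (e j) = (1 : Matrix (Fin n) (Fin n) K) i j := by
  classical
  have hcard : Fintype.card (Fin n) ≤
      Fintype.card (Finset.univ.finsuppAntidiag t : Finset (Fin 4 →₀ ℕ)) := by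
    rw [Fintype.card_coe, Finset.card_finsuppAntidiag_nat_eq_choose, Fintype.card_fin,
      Finset.card_univ, Fintype.card_fin, show 4 + t - 1 = t + 3 by omega, Nat.choose_symm_add]
    exact h
  obtain ⟨β⟩ := Function.Embedding.nonempty_of_card_le hcard
  have hdeg : ∀ k, (β k).1.degree = t := by
    intro k
    rw [Finsupp.degree_eq_sum]
    exact (Finset.mem_finsuppAntidiag.1 (β k).2).1
  refine ⟨_, det_monomial_ne_zero (K := K) (Subtype.val_injective.comp β.injective),
    fun v hv => ?_⟩
  set A : Matrix (Fin n) (Fin n) K := Matrix.of fun i k => eval (v i) (monomial (β k).1 1) with hA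
  have hAdet : A.det ≠ 0 := by
    rw [RingHom.map_det] at hv
    convert! hv using 2
    ext i k
    simp [hA, eval_rename, Function.comp_def]
  refine ⟨fun j => ∑ k, C (A⁻¹ k j) * monomial (β k).1 1, fun j => ?_, fun i j => ?_⟩
  · exact IsHomogeneous.sum _ _ _ fun k _ => (isHomogeneous_monomial _ (hdeg k)).C_mul _
  · rw [← Matrix.mul_nonsing_inv A (isUnit_iff_ne_zero.2 hAdet), Matrix.mul_apply, map_sum]
    refine Finset.sum_congr rfl fun k _ => ?_
    rw [map_mul, eval_C, mul_comm, hA, Matrix.of_apply]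

end GenericPolynomials

section GeneralPosition

variable {K : Type} [Field K]

theorem map_translateVars_pointIdeal_le (v : Fin 4 → K) :
    (pointIdeal K v).map (translateVars v) ≤ idealOfVars (Fin 4) K := by
  rw [Ideal.map_le_iff_le_comap, pointIdeal, Ideal.span_le]
  rintro g ⟨-, hg⟩
  rw [SetLike.mem_coe, Ideal.mem_comap, ← pow_one (idealOfVars _ _), mem_pow_idealOfVars_iff']
  intro x hx
  obtain rfl : x = 0 := by rw [← Finsupp.degree_eq_zero_iff]; omega
  have : (constantCoeff.comp (translateVars v).toRingHom) = eval v := by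
    ext i <;> simp [translateVars]
  rw [← constantCoeff_eq, ← hg, ← this]
  rfl

theorem translateVars_mem_of_mem_pointIdeal_pow {v : Fin 4 → K} {m : ℕ}
    {f : MvPolynomial (Fin 4) K} (hf : f ∈ pointIdeal K v ^ m) :
    translateVars v f ∈ idealOfVars (Fin 4) K ^ m :=
  Ideal.pow_right_mono (map_translateVars_pointIdeal_le v) m
    (Ideal.map_pow (translateVars v) (pointIdeal K v) m ▸ Ideal.mem_map_of_mem _ hf)

theorem homogeneousComponent_mem_pointIdeal_pow {v : Fin 4 → K} {m : ℕ}
    {f : MvPolynomial (Fin 4) K} (hf : f ∈ pointIdeal K v ^ m) (d : ℕ) :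
    homogeneousComponent d f ∈ pointIdeal K v ^ m := by
  rw [pointIdeal_pow_eq_span] at hf ⊢
  exact homogeneousComponent_mem_span
    (isHomogeneous_of_mem_set_pow (e := 1) (fun g hg => hg.1) m) hf d

theorem eval_smul_of_isHomogeneous {σ : Type*} {f : MvPolynomial σ K} {d : ℕ}
    (hf : f.IsHomogeneous d) (c : K) (u : σ → K) : eval (c • u) f = c ^ d * eval u f := by
  rw [eval_eq, eval_eq, Finset.mul_sum]
  refine Finset.sum_congr rfl fun x hx => ?_
  have hd : ∑ i ∈ x.support, x i = d := (hf.degree_eq_sum_deg_support hx).symm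
  simp only [Pi.smul_apply, smul_eq_mul, mul_pow, Finset.prod_mul_distrib,
    Finset.prod_pow_eq_pow_sum, hd]
  ring

theorem eval_restrictHead {N : ℕ} (a : K) (y : Fin N → K) (f : MvPolynomial (Fin (N + 1)) K) :
    eval y (restrictHead a f) = eval (Fin.cons a y : Fin (N + 1) → K) f := by
  have : (eval y).comp (restrictHead a).toRingHom =
      eval (Fin.cons a y : Fin (N + 1) → K) := by
    ext i
    · simp
    · refine Fin.cases ?_ (fun i => ?_) i <;> simp [restrictHead]
  exact congrArg (fun φ => φ f) this

variable [CharZero K]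

theorem eq_zero_of_restrictHead_one_eq_zero {N D : ℕ} {f : MvPolynomial (Fin (N + 1)) K}
    (hf : f.IsHomogeneous D) (h : restrictHead 1 f = 0) : f = 0 := by
  suffices H : X 0 * f = 0 from (mul_eq_zero.1 H).resolve_left (X_ne_zero 0)
  refine MvPolynomial.funext fun w => ?_
  rw [map_mul, eval_X, map_zero]
  by_cases hw : w 0 = 0
  · rw [hw, zero_mul]
  · have h1 : w = w 0 • (Fin.cons 1 (fun i => w i.succ / w 0) : Fin (N + 1) → K) := by
      ext i
      refine Fin.cases ?_ (fun i => ?_) i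
      · simp
      · simp
        field_simp
    rw [h1, eval_smul_of_isHomogeneous hf, ← eval_restrictHead, h]
    simp

theorem exists_points_no_form {n r t : ℕ} (hr : 2 ≤ r) (ht : (t + 2).choose 3 < n) :
    ∃ p : Fin n → Fin 4 → K, ∀ f : MvPolynomial (Fin 4) K,
      f.IsHomogeneous (r * (t + 1) - 1) →
      (∀ j, translateVars (p j) f ∈ idealOfVars (Fin 4) K ^ (3 * r - 2)) → f = 0 := by
  obtain ⟨p, hp⟩ := exists_special_points (K := K) hr ht
  refine ⟨fun j => Fin.cons 1 (p j), fun f hf h => ?_⟩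
  by_contra hf0
  have h1 := hp (restrictHead 1 f) (fun h0 => hf0 (eq_zero_of_restrictHead_one_eq_zero hf h0))
    fun j => translateVars_mem_of_restrictHead (h j)
  have h2 : (restrictHead 1 f).totalDegree ≤ f.totalDegree :=
    totalDegree_aeval_le _ (fun i => by refine Fin.cases ?_ (fun i => ?_) i <;> simp) f
  have h3 := hf.totalDegree_le
  have h4 : 0 < r * (t + 1) := by positivity
  omega

/-- There are, for generic points, linear forms vanishing at exactly one of them. -/
theorem exists_generic_linear (K : Type) [Field K] (n : ℕ) :
    ∃ G : MvPolynomial (Fin n × Fin 4) K, G ≠ 0 ∧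
      ∀ v : Fin n → Fin 4 → K, eval (fun q => v q.1 q.2) G ≠ 0 →
        (∀ j, v j 0 ≠ 0) ∧ ∃ lam : Fin n → MvPolynomial (Fin 4) K,
          (∀ j, (lam j).IsHomogeneous 1) ∧ (∀ j, eval (v j) (lam j) = 0) ∧
          ∀ i j, i ≠ j → eval (v i) (lam j) ≠ 0 := by
  classical
  refine ⟨(∏ j, X (j, 0)) * ∏ j, ∏ i ∈ Finset.univ.erase j,
    (X (j, 0) * X (i, 1) - X (j, 1) * X (i, 0)), ?_, fun v hv => ?_⟩
  · refine mul_ne_zero (Finset.prod_ne_zero_iff.2 fun j _ => X_ne_zero _)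
      (Finset.prod_ne_zero_iff.2 fun j _ => Finset.prod_ne_zero_iff.2 fun i hi h0 => ?_)
    have hij : i ≠ j := Finset.ne_of_mem_erase hi
    have h1 := congrArg (eval fun q : Fin n × Fin 4 =>
      if q = (j, 0) ∨ q = (i, 1) then (1 : K) else 0) h0
    simp [hij, hij.symm] at h1
  · simp only [map_mul, map_prod, map_sub, eval_X] at hv
    have h1 := left_ne_zero_of_mul hv
    have h2 := right_ne_zero_of_mul hv
    rw [Finset.prod_ne_zero_iff] at h1 h2
    refine ⟨fun j => h1 j (Finset.mem_univ j), fun j => C (v j 0) * X 1 - C (v j 1) * X 0,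
      fun j => (isHomogeneous_C_mul_X _ _).sub (isHomogeneous_C_mul_X _ _), fun j => ?_,
      fun i j hij => ?_⟩
    · simp [mul_comm]
    · have h3 := Finset.prod_ne_zero_iff.1 (h2 j (Finset.mem_univ j)) i
        (Finset.mem_erase.2 ⟨hij, Finset.mem_univ i⟩)
      simpa using h3

theorem exists_choose_three_lt_and_le {n : ℕ} (hn : 1 ≤ n) :
    ∃ t : ℕ, (t + 2).choose 3 < n ∧ n ≤ (t + 3).choose 3 := by
  have hex : ∃ t : ℕ, n ≤ (t + 3).choose 3 := by
    refine ⟨n, ?_⟩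
    have := six_mul_choose_three (n + 1)
    nlinarith [sq_nonneg n, Nat.zero_le (n ^ 3)]
  classical
  refine ⟨Nat.find hex, ?_, Nat.find_spec hex⟩
  rcases h : Nat.find hex with - | t
  · rw [zero_add, Nat.choose_eq_zero_of_lt (by norm_num)]
    exact hn
  · have := Nat.find_min hex (m := t) (by omega)
    simpa using this

end GeneralPosition

/-- Harbourne–Huneke containment `I^(3r-2) ⊆ I^r` for simple points in general
position in `ℙ³`. -/
theorem harbourne_huneke_containment (K : Type) [Field K] [CharZero K] (n r : ℕ)
    (hn : 1 ≤ n) (hr : 1 ≤ r) :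
    ∃ G : MvPolynomial (Fin n × Fin 4) K, G ≠ 0 ∧
      ∀ v : Fin n → Fin 4 → K, (∀ j, v j ≠ 0) →
        eval (fun p => v p.1 p.2) G ≠ 0 →
        (⨅ j, pointIdeal K (v j) ^ (3 * r - 2)) ≤ (⨅ j, pointIdeal K (v j)) ^ r := by
  rcases hr.eq_or_lt with rfl | hr2
  · exact ⟨1, one_ne_zero, fun v _ _ => by simp⟩
  obtain ⟨t, ht, htn⟩ := exists_choose_three_lt_and_le hn
  obtain ⟨p, hp⟩ := exists_points_no_form (K := K) hr2 ht
  obtain ⟨G₁, hG₁, h₁⟩ := exists_generic_translateVars p hp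
  obtain ⟨G₂, hG₂, h₂⟩ := exists_generic_separating (K := K) htn
  obtain ⟨G₃, hG₃, h₃⟩ := exists_generic_linear K n
  refine ⟨G₁ * (G₂ * G₃), mul_ne_zero hG₁ (mul_ne_zero hG₂ hG₃), fun v _ hv => ?_⟩
  rw [map_mul, map_mul, mul_ne_zero_iff, mul_ne_zero_iff] at hv
  obtain ⟨hv₁, hv₂, hv₃⟩ := hv
  obtain ⟨e, he, hev⟩ := h₂ v hv₂
  obtain ⟨hv0, lam, hlam, hlam0, hlam1⟩ := h₃ v hv₃
  have hs : IsSeparating v t e lam :=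
    ⟨hv0, he, fun j => by simp [hev], fun i j hij => by simp [hev, hij], hlam, hlam0, hlam1⟩
  intro f hf
  rw [Submodule.mem_iInf] at hf
  rw [← sum_homogeneousComponent f]
  refine sum_mem fun d _ => ?_
  have hd : ∀ j, homogeneousComponent d f ∈ pointIdeal K (v j) ^ (3 * r - 2) :=
    fun j => homogeneousComponent_mem_pointIdeal_pow (hf j) d
  have hhom := homogeneousComponent_isHomogeneous d f
  by_cases hdr : r * (t + 1) ≤ d
  · obtain ⟨k, rfl⟩ := Nat.exists_eq_add_of_le hdr
    exact Ideal.pow_right_mono (le_iInf fun j => formsIdeal_le_pointIdeal hv0 j) r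
      (hs.mem_formsIdeal_pow r k hhom fun j => Ideal.pow_le_pow_right (by omega) (hd j))
  · have h0 := h₁ v hv₁ (homogeneousComponent d f * X 0 ^ (r * (t + 1) - 1 - d))
      (by convert! hhom.mul (isHomogeneous_X_pow 0 _) using 1; omega)
      fun j => translateVars_mem_of_mem_pointIdeal_pow (Ideal.mul_mem_right _ _ (hd j))
    rw [(mul_eq_zero.1 h0).resolve_right (pow_ne_zero _ (X_ne_zero 0))]
    exact zero_mem _

end
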